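/- Consider the saddle-point problem min_x max_y f(x) + ⟨Lx, y⟩ − g*(y) admitting at least one KKT point, i.e. a pair (x⋆, y⋆) with −L*y⋆ ∈ ∂f(x⋆) and Lx⋆ ∈ ∂g*(y⋆). Let (x_k), (y_k) be generated by the Chambolle–Pock iteration x_{k+1} = prox_{τf}(x_k − τ L* y_k), y_{k+1} = prox_{σ g*}(y_k + σ L(x_{k+1} + θ(x_{k+1} − x_k))) from an arbitrary initial point (x₀, y₀), with θ > 1/2 and τ, σ > 0 satisfying τσ‖L‖² < 4/(1 + 2θ). Then (x_k, y_k) converges weakly to some KKT point (x⋆, y⋆) of the problem. -/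

import Mathlib

open scoped RealInnerProductSpace
open Filter Topology

noncomputable section

/-- The convex subdifferential of an extended-real-valued function:
`∂f(x) = { u : ∀ z, f z ≥ f x + ⟪u, z - x⟫ }`. -/
def ESubdiff {E : Type*} [NormedAddCommGroup E] [InnerProductSpace ℝ E]
    (f : E → EReal) (x : E) : Set E :=
  {u | ∀ z : E, f x + ((⟪u, z - x⟫ : ℝ) : EReal) ≤ f z}

/-- Properness of an extended-real-valued function: it never takes the value `⊥`
and is not identically `⊤`. -/
def EProper {E : Type*} (f : E → EReal) : Prop :=
  (∃ x, f x ≠ ⊤) ∧ ∀ x, f x ≠ ⊥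

/-- Convexity of an extended-real-valued function. -/
def EConvex {E : Type*} [NormedAddCommGroup E] [NormedSpace ℝ E] (f : E → EReal) : Prop :=
  ∀ x y : E, ∀ a b : ℝ, 0 ≤ a → 0 ≤ b → a + b = 1 →
    f (a • x + b • y) ≤ (a : EReal) * f x + (b : EReal) * f y

/-- The convex (Fenchel) conjugate `g*(y) = sup_x (⟪x, y⟫ - g x)`. -/
def EConj {E : Type*} [NormedAddCommGroup E] [InnerProductSpace ℝ E]
    (g : E → EReal) (y : E) : EReal :=
  ⨆ x : E, ((⟪x, y⟫ : ℝ) : EReal) - g x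

/-- `IsProx τ f x p` states that `p = prox_{τ f}(x)`, i.e. `p` minimizes
`fun z => f z + (1/(2τ)) ‖z - x‖²`. -/
def IsProx {E : Type*} [NormedAddCommGroup E] [InnerProductSpace ℝ E]
    (τ : ℝ) (f : E → EReal) (x p : E) : Prop :=
  ∀ z : E, f p + ((1 / (2 * τ) * ‖p - x‖ ^ 2 : ℝ) : EReal)
      ≤ f z + ((1 / (2 * τ) * ‖z - x‖ ^ 2 : ℝ) : EReal)

/-- The Lagrangian `𝓛(x, y) = f x + ⟪y, L x⟫ - g*(y)` of the saddle-point problem. -/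
def Lagr {E F : Type*} [NormedAddCommGroup E] [InnerProductSpace ℝ E]
    [NormedAddCommGroup F] [InnerProductSpace ℝ F]
    (f : E → EReal) (gs : F → EReal) (L : E →L[ℝ] F) (x : E) (y : F) : EReal :=
  f x + ((⟪y, L x⟫ : ℝ) : EReal) - gs y

section ExtendedReal

variable {E : Type*} [NormedAddCommGroup E] [InnerProductSpace ℝ E]

lemma EConvex.le_coe {f : E → EReal} (hf : EConvex f) {x y : E} {r s a b : ℝ}
    (hx : f x ≤ r) (hy : f y ≤ s) (ha : 0 ≤ a) (hb : 0 ≤ b) (hab : a + b = 1) :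
    f (a • x + b • y) ≤ ((a * r + b * s : ℝ) : EReal) := by
  refine (hf x y a b ha hb hab).trans ?_
  push_cast
  exact add_le_add (mul_le_mul_of_nonneg_left hx (by exact_mod_cast ha))
    (mul_le_mul_of_nonneg_left hy (by exact_mod_cast hb))

/-- A point outside the epigraph of a convex lower semicontinuous function is strictly separated
from it. -/
lemma EConvex.exists_separation [CompleteSpace E] {f : E → EReal} (hf : EConvex f)
    (hlsc : LowerSemicontinuous f) {a : E} {r : ℝ} (ha : ¬ f a ≤ r) :
    ∃ (w : E) (s u : ℝ), ⟪a, w⟫ + s * r < u ∧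
      ∀ (x : E) (t : ℝ), f x ≤ t → u < ⟪x, w⟫ + s * t := by
  have hconv : Convex ℝ {p : E × ℝ | f p.1 ≤ (p.2 : EReal)} := by
    intro p hp q hq c d hc hd hcd
    simpa using hf.le_coe hp hq hc hd hcd
  have hclosed : IsClosed {p : E × ℝ | f p.1 ≤ (p.2 : EReal)} :=
    hlsc.isClosed_epigraph.preimage
      (continuous_fst.prodMk (continuous_coe_real_ereal.comp continuous_snd))
  obtain ⟨φ, u, h₁, h₂⟩ := geometric_hahn_banach_point_closed hconv hclosed
    (x := (a, r)) (by simpa using ha)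
  have key (x : E) (t : ℝ) : φ (x, t) =
      ⟪x, (InnerProductSpace.toDual ℝ E).symm (φ.comp (ContinuousLinearMap.inl ℝ E ℝ))⟫
        + φ (0, 1) * t := by
    rw [real_inner_comm, InnerProductSpace.toDual_symm_apply]
    have : (x, t) = (x, 0) + t • ((0 : E), (1 : ℝ)) := by simp
    rw [this, map_add, map_smul]
    simp [mul_comm]
  refine ⟨_, φ (0, 1), u, by rw [← key]; exact h₁, fun x t hxt => by
    rw [← key]; exact h₂ (x, t) hxt⟩

/-- Weak sequential lower semicontinuity of a convex lower semicontinuous function, stated along an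
arbitrary nontrivial filter. -/
lemma EConvex.le_of_tendsto_inner [CompleteSpace E] {f : E → EReal} (hf : EConvex f)
    (hlsc : LowerSemicontinuous f) {ι : Type*} {l : Filter ι} [l.NeBot] {x : ι → E} {t : ι → ℝ}
    {a : E} {r : ℝ} (hx : ∀ u, Tendsto (fun i => ⟪x i, u⟫) l (𝓝 ⟪a, u⟫))
    (ht : Tendsto t l (𝓝 r)) (hle : ∀ᶠ i in l, f (x i) ≤ t i) : f a ≤ r := by
  by_contra ha
  obtain ⟨w, s, u, h₁, h₂⟩ := hf.exists_separation hlsc ha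
  exact absurd (ge_of_tendsto ((hx w).add (ht.const_mul s))
    (hle.mono fun i hi => (h₂ _ _ hi).le)) (not_le.mpr h₁)

lemma IsProx.ne_top {f : E → EReal} {τ : ℝ} {x p : E} (hdom : ∃ x, f x ≠ ⊤)
    (hp : IsProx τ f x p) : f p ≠ ⊤ := by
  obtain ⟨z, hz⟩ := hdom
  intro htop
  have := hp z
  rw [htop, EReal.top_add_coe, top_le_iff] at this
  exact (EReal.add_ne_top hz (EReal.coe_ne_top _)) this

lemma IsProx.mem_ESubdiff {f : E → EReal} (hf : EConvex f) (hproper : EProper f) {τ : ℝ}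
    (hτ : 0 < τ) {x p : E} (hp : IsProx τ f x p) : τ⁻¹ • (x - p) ∈ ESubdiff f p := by
  have hpt := hp.ne_top hproper.1
  intro z
  rcases eq_or_ne (f z) ⊤ with hz | hz
  · rw [hz]; exact le_top
  lift f p to ℝ using ⟨hpt, hproper.2 p⟩ with P hP
  lift f z to ℝ using ⟨hz, hproper.2 z⟩ with Z hZ
  norm_cast
  have step : ∀ t ∈ Set.Ioo (0 : ℝ) 1,
      P + ⟪τ⁻¹ • (x - p), z - p⟫ ≤ Z + t * (1 / (2 * τ) * ‖z - p‖ ^ 2) := by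
    intro t ht
    have h₁ := hf.le_coe hP.symm.le hZ.symm.le (by linarith [ht.2] : 0 ≤ 1 - t) ht.1.le (by ring)
    have h₂ := (hp ((1 - t) • p + t • z)).trans (add_le_add_left h₁ _)
    rw [← hP] at h₂
    norm_cast at h₂
    have h₃ : (1 - t) • p + t • z - x = (p - x) + t • (z - p) := by module
    rw [h₃, norm_add_sq_real, norm_smul, Real.norm_of_nonneg ht.1.le, inner_smul_right] at h₂
    have h₄ : ⟪τ⁻¹ • (x - p), z - p⟫ = - (τ⁻¹ * ⟪p - x, z - p⟫) := by
      rw [inner_smul_left, ← neg_sub p x, inner_neg_left]; simp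
    rw [h₄]
    have h₅ : t * (P - τ⁻¹ * ⟪p - x, z - p⟫) ≤ t * (Z + t * (1 / (2 * τ) * ‖z - p‖ ^ 2)) := by
      have : 1 / (2 * τ) * (2 * (t * ⟪p - x, z - p⟫)) = t * (τ⁻¹ * ⟪p - x, z - p⟫) := by
        field_simp
      nlinarith
    have := le_of_mul_le_mul_left h₅ ht.1
    linarith
  have hlim : Tendsto (fun t : ℝ => Z + t * (1 / (2 * τ) * ‖z - p‖ ^ 2)) (𝓝[>] 0)
      (𝓝 (Z + 0 * (1 / (2 * τ) * ‖z - p‖ ^ 2))) :=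
    Tendsto.mono_left (Continuous.tendsto (by fun_prop) 0) nhdsWithin_le_nhds
  have := ge_of_tendsto hlim
    (Filter.mem_of_superset (Ioo_mem_nhdsGT (zero_lt_one' ℝ)) step)
  simpa using this

lemma EConvex.econj (g : E → EReal) (hg : ∀ x, g x ≠ ⊥) : EConvex (EConj g) := by
  intro x y a b ha hb hab
  refine iSup_le fun z => ?_
  rcases eq_or_ne (g z) ⊤ with hz | hz
  · simp [hz]
  have hle (v : E) : ((⟪z, v⟫ : ℝ) : EReal) - g z ≤ EConj g v :=
    le_iSup (fun z => ((⟪z, v⟫ : ℝ) : EReal) - g z) z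
  have hx := hle x
  have hy := hle y
  lift g z to ℝ using ⟨hz, hg z⟩ with r
  refine le_trans ?_ (add_le_add
    (mul_le_mul_of_nonneg_left hx (by exact_mod_cast ha : (0 : EReal) ≤ a))
    (mul_le_mul_of_nonneg_left hy (by exact_mod_cast hb : (0 : EReal) ≤ b)))
  norm_cast
  rw [inner_add_right, inner_smul_right, inner_smul_right]
  apply le_of_eq
  linear_combination r * hab

lemma lowerSemicontinuous_econj (g : E → EReal) : LowerSemicontinuous (EConj g) := by
  refine lowerSemicontinuous_iSup fun z => ?_
  induction h : g z with
  | bot => simpa using lowerSemicontinuous_const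
  | top => simpa using lowerSemicontinuous_const
  | coe r =>
    norm_cast
    exact (continuous_coe_real_ereal.comp (by fun_prop)).lowerSemicontinuous

lemma EProper.econj [CompleteSpace E] {g : E → EReal} (hg : EProper g) (hconv : EConvex g)
    (hlsc : LowerSemicontinuous g) : EProper (EConj g) := by
  obtain ⟨⟨x₀, hx₀⟩, hbot⟩ := hg
  have hr := EReal.coe_toReal hx₀ (hbot x₀)
  set r := (g x₀).toReal
  constructor
  · obtain ⟨w, s, u, h₁, h₂⟩ := hconv.exists_separation hlsc (a := x₀) (r := r - 1) (by
      rw [← hr]; norm_cast; linarith)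
    have hs : 0 < s := by
      have := h₂ x₀ r hr.ge
      linarith
    refine ⟨-(s⁻¹ • w), ne_top_of_le_ne_top (EReal.coe_ne_top (-(u / s))) (iSup_le fun z => ?_)⟩
    rcases eq_or_ne (g z) ⊤ with hz | hz
    · simp [hz]
    have h₃ := h₂ z (g z).toReal (EReal.coe_toReal hz (hbot z)).ge
    lift g z to ℝ using ⟨hz, hbot z⟩ with t
    norm_cast
    rw [inner_neg_right, inner_smul_right]
    rw [EReal.toReal_coe] at h₃
    have : u / s < s⁻¹ * ⟪z, w⟫ + t := by
      rw [div_lt_iff₀ hs]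
      calc u < ⟪z, w⟫ + s * t := h₃
        _ = (s⁻¹ * ⟪z, w⟫ + t) * s := by field_simp
    linarith
  · intro y
    have h : ((⟪x₀, y⟫ : ℝ) : EReal) - g x₀ ≤ EConj g y :=
      le_iSup (fun z => ((⟪z, y⟫ : ℝ) : EReal) - g z) x₀
    rw [← hr] at h
    norm_cast at h
    exact ne_bot_of_le_ne_bot (EReal.coe_ne_bot _) h

lemma EProper.ne_top_of_mem_ESubdiff {f : E → EReal} (hf : EProper f) {x u : E}
    (hu : u ∈ ESubdiff f x) : f x ≠ ⊤ := by
  obtain ⟨z, hz⟩ := hf.1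
  intro htop
  have := hu z
  rw [htop, EReal.top_add_coe, top_le_iff] at this
  exact hz this

end ExtendedReal

/-- A bounded family in a Hilbert space converges weakly along every ultrafilter. -/
lemma Ultrafilter.exists_tendsto_inner {E ι : Type*} [NormedAddCommGroup E]
    [InnerProductSpace ℝ E] [CompleteSpace E] (U : Ultrafilter ι) {x : ι → E} {C : ℝ}
    (hC : ∀ i, ‖x i‖ ≤ C) : ∃ a, ∀ u, Tendsto (fun i => ⟪x i, u⟫) U (𝓝 ⟪a, u⟫) := by
  let φ : ι → WeakDual ℝ E := fun i =>
    StrongDual.toWeakDual (InnerProductSpace.toDual ℝ E (x i))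
  obtain ⟨ψ, -, hψ⟩ := (WeakDual.isCompact_closedBall (𝕜 := ℝ) (E := E) 0 C).ultrafilter_le_nhds
    (U.map φ) (by
      rw [le_principal_iff]
      exact Filter.mem_map.mpr (Filter.univ_mem' fun i => by simpa [φ] using hC i))
  refine ⟨(InnerProductSpace.toDual ℝ E).symm (WeakDual.toStrongDual ψ), fun u => ?_⟩
  rw [InnerProductSpace.toDual_symm_apply]
  exact ((WeakDual.eval_continuous u).tendsto ψ).comp hψ

section Lyapunov

variable {E F : Type*} [NormedAddCommGroup E] [InnerProductSpace ℝ E]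
  [NormedAddCommGroup F] [InnerProductSpace ℝ F]

/-- The Lyapunov function of the Chambolle-Pock method, relative to a KKT point at the origin:
`x₀`, `x₁` and `y₀`, `y₁` are consecutive iterates and `p` is the primal gap at `x₁`. -/
def cpLyapunov (τ σ θ : ℝ) (A : F →L[ℝ] E) (x₀ x₁ : E) (y₀ y₁ : F) (p : ℝ) : ℝ :=
  ‖x₁‖ ^ 2 / (2 * τ) + ‖y₁‖ ^ 2 / (2 * σ) - ⟪x₁, A y₁⟫
    + τ / 4 * ‖τ⁻¹ • (x₁ - x₀) - A (y₁ - y₀)‖ ^ 2 + (θ - 1) * p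

lemma cpLyapunov_descent {τ σ θ : ℝ} (hτ : 0 < τ) (hσ : 0 < σ) (hθ : 1 / 2 < θ) (A : F →L[ℝ] E)
    {x₀ x₁ x₂ : E} {y₀ y₁ y₂ : F} {p₁ p₂ q₂ : ℝ}
    (h₁ : p₂ + ⟪τ⁻¹ • (x₁ - x₂) - A y₁, -x₂⟫ ≤ 0)
    (h₂ : p₂ + ⟪τ⁻¹ • (x₁ - x₂) - A y₁, x₁ - x₂⟫ ≤ p₁)
    (h₃ : p₁ + ⟪τ⁻¹ • (x₀ - x₁) - A y₀, x₂ - x₁⟫ ≤ p₂)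
    (h₄ : q₂ + (⟪σ⁻¹ • (y₁ - y₂), -y₂⟫ + ⟪x₂ + θ • (x₂ - x₁), A (-y₂)⟫) ≤ 0) :
    cpLyapunov τ σ θ A x₁ x₂ y₁ y₂ p₂
      + ((θ - 1 / 2) / τ * ‖x₂ - x₁ - (τ / 2) • A (y₂ - y₁)‖ ^ 2
        + (1 / (2 * σ) - τ * (1 + 2 * θ) / 8 * ‖A‖ ^ 2) * ‖y₂ - y₁‖ ^ 2 + p₂ + q₂)
      ≤ cpLyapunov τ σ θ A x₀ x₁ y₀ y₁ p₁ := by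
  have hA : τ * (1 + 2 * θ) / 8 * ‖A (y₂ - y₁)‖ ^ 2
      ≤ τ * (1 + 2 * θ) / 8 * (‖A‖ ^ 2 * ‖y₂ - y₁‖ ^ 2) := by
    rw [← mul_pow]
    gcongr
    exact A.le_opNorm _
  have hsq : 0 ≤ τ / 4 * ‖τ⁻¹ • (x₂ - x₁) - (τ⁻¹ • (x₁ - x₀) - A (y₁ - y₀))‖ ^ 2 := by positivity
  have h₂' := mul_le_mul_of_nonneg_left h₂ (by linarith : 0 ≤ θ - 1 / 2)
  unfold cpLyapunov
  simp only [← real_inner_self_eq_norm_sq, map_sub, map_neg, inner_sub_left, inner_sub_right,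
    inner_add_left, inner_smul_left, inner_smul_right, inner_neg_right, conj_trivial,
    real_inner_comm] at *
  linear_combination (norm := (apply le_of_eq; field_simp; ring))
    h₁ + h₄ + h₂' + (1 / 2) * h₃ + hA + hsq

lemma cpLyapunov_lower_bound {τ σ θ : ℝ} (hτ : 0 < τ) (A : F →L[ℝ] E)
    {x₀ x₁ : E} {y₀ y₁ : F} {p₁ : ℝ}
    (h₁ : p₁ + ⟪τ⁻¹ • (x₀ - x₁) - A y₀, -x₁⟫ ≤ 0) :
    τ / 4 * ‖τ⁻¹ • x₁ - A y₁‖ ^ 2 + (1 / (2 * σ) - τ / 4 * ‖A‖ ^ 2) * ‖y₁‖ ^ 2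
        + (θ - 1 / 2) * p₁ ≤ cpLyapunov τ σ θ A x₀ x₁ y₀ y₁ p₁ := by
  have hA : τ / 4 * ‖A y₁‖ ^ 2 ≤ τ / 4 * (‖A‖ ^ 2 * ‖y₁‖ ^ 2) := by
    rw [← mul_pow]
    gcongr
    exact A.le_opNorm _
  have hsq : 0 ≤ τ / 4 * ‖τ⁻¹ • (x₁ - x₀) - A (y₁ - y₀) + τ⁻¹ • x₁‖ ^ 2 := by positivity
  unfold cpLyapunov
  simp only [← real_inner_self_eq_norm_sq, map_sub, inner_sub_left, inner_sub_right,
    inner_add_left, inner_add_right, inner_smul_left, inner_smul_right, inner_neg_right, conj_trivial,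
    real_inner_comm] at *
  linear_combination (norm := (apply le_of_eq; field_simp; ring)) (1 / 2) * h₁ + hA + hsq

end Lyapunov

section Convergence

variable {E F : Type*} [NormedAddCommGroup E] [InnerProductSpace ℝ E]
  [NormedAddCommGroup F] [InnerProductSpace ℝ F]

lemma tendsto_zero_of_mul_norm_sq_le {ι G : Type*} [NormedAddCommGroup G] {l : Filter ι}
    {c : ℝ} (hc : 0 < c) {v : ι → G} {r : ι → ℝ} (hr : Tendsto r l (𝓝 0))
    (h : ∀ i, c * ‖v i‖ ^ 2 ≤ r i) : Tendsto v l (𝓝 0) := by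
  rw [tendsto_zero_iff_norm_tendsto_zero]
  have h₁ : Tendsto (fun i => ‖v i‖ ^ 2) l (𝓝 0) := by
    refine squeeze_zero (fun i => by positivity) (fun i => (le_div_iff₀' hc).2 (h i)) ?_
    simpa using hr.div_const c
  simpa using h₁.sqrt

lemma tendsto_inner_zero_of_bounded {ι : Type*} {l : Filter ι} {d v : ι → E} {C : ℝ}
    (hd : Tendsto d l (𝓝 0)) (hv : ∀ i, ‖v i‖ ≤ C) :
    Tendsto (fun i => ⟪d i, v i⟫) l (𝓝 0) := by
  refine squeeze_zero_norm (fun i => (norm_inner_le_norm _ _).trans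
    (mul_le_mul_of_nonneg_left (hv i) (norm_nonneg _))) ?_
  simpa using hd.norm.mul_const C

/-- Consequences of the Lyapunov descent, for a sequence of iterates relative to a KKT point at the
origin with primal gaps `P` and dual gaps `Q`. -/
lemma cpLyapunov_convergence {τ σ θ : ℝ} (hτ : 0 < τ) (hσ : 0 < σ) (hθ : 1 / 2 < θ)
    {A : F →L[ℝ] E} (hstep : τ * σ * ‖A‖ ^ 2 < 4 / (1 + 2 * θ))
    {X : ℕ → E} {Y : ℕ → F} {P Q : ℕ → ℝ} (hP : ∀ k, 0 ≤ P (k + 1)) (hQ : ∀ k, 0 ≤ Q (k + 1))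
    (h₁ : ∀ k, P (k + 1) + ⟪τ⁻¹ • (X k - X (k + 1)) - A (Y k), -X (k + 1)⟫ ≤ 0)
    (h₂ : ∀ k j, P (k + 1) + ⟪τ⁻¹ • (X k - X (k + 1)) - A (Y k), X (j + 1) - X (k + 1)⟫
      ≤ P (j + 1))
    (h₃ : ∀ k, Q (k + 1) + (⟪σ⁻¹ • (Y k - Y (k + 1)), -Y (k + 1)⟫
      + ⟪X (k + 1) + θ • (X (k + 1) - X k), A (-Y (k + 1))⟫) ≤ 0) :
    (∃ C, ∀ k, ‖X (k + 1)‖ ≤ C) ∧ (∃ C, ∀ k, ‖Y (k + 1)‖ ≤ C) ∧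
    Tendsto (fun k => X (k + 1) - X k) atTop (𝓝 0) ∧
    Tendsto (fun k => Y (k + 1) - Y k) atTop (𝓝 0) ∧
    Tendsto (fun k => P (k + 1)) atTop (𝓝 0) ∧ Tendsto (fun k => Q (k + 1)) atTop (𝓝 0) ∧
    ∃ V, Tendsto (fun k => ‖X (k + 1)‖ ^ 2 / (2 * τ) + ‖Y (k + 1)‖ ^ 2 / (2 * σ)
      - ⟪X (k + 1), A (Y (k + 1))⟫) atTop (𝓝 V) := by
  set Λ : ℕ → ℝ := fun k => cpLyapunov τ σ θ A (X k) (X (k + 1)) (Y k) (Y (k + 1)) (P (k + 1))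
  rw [lt_div_iff₀ (by linarith)] at hstep
  have hc₁ : 0 < 1 / (2 * σ) - τ * (1 + 2 * θ) / 8 * ‖A‖ ^ 2 := by
    have : 1 / (2 * σ) - τ * (1 + 2 * θ) / 8 * ‖A‖ ^ 2
        = (4 - τ * σ * ‖A‖ ^ 2 * (1 + 2 * θ)) / (8 * σ) := by field_simp; ring
    rw [this]
    exact div_pos (by linarith) (by linarith)
  have hc₂ : 0 < 1 / (2 * σ) - τ / 4 * ‖A‖ ^ 2 := by
    have : 0 ≤ τ / 8 * (2 * θ - 1) * ‖A‖ ^ 2 :=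
      mul_nonneg (mul_nonneg (by linarith) (by linarith)) (by positivity)
    linarith
  have hc₃ : 0 < (θ - 1 / 2) / τ := div_pos (by linarith) hτ
  have hdesc (k : ℕ) := cpLyapunov_descent hτ hσ hθ A (h₁ (k + 1)) (h₂ (k + 1) k)
    (h₂ k (k + 1)) (h₃ (k + 1))
  have hlow (k : ℕ) := cpLyapunov_lower_bound (σ := σ) (θ := θ) (y₁ := Y (k + 1)) hτ A (h₁ k)
  have hgap (k : ℕ) : 0 ≤ (θ - 1 / 2) * P (k + 1) := mul_nonneg (by linarith) (hP k)
  have hres₁ (k : ℕ) := mul_nonneg hc₃.le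
    (sq_nonneg ‖X (k + 2) - X (k + 1) - (τ / 2) • A (Y (k + 2) - Y (k + 1))‖)
  have hres₂ (k : ℕ) := mul_nonneg hc₁.le (sq_nonneg ‖Y (k + 2) - Y (k + 1)‖)
  have hlow₁ (k : ℕ) := mul_nonneg (by positivity : 0 ≤ τ / 4)
    (sq_nonneg ‖τ⁻¹ • X (k + 1) - A (Y (k + 1))‖)
  have hlow₂ (k : ℕ) := mul_nonneg hc₂.le (sq_nonneg ‖Y (k + 1)‖)
  have hanti : Antitone Λ := antitone_nat_of_succ_le fun k => by
    linarith [hdesc k, hres₁ k, hres₂ k, hP (k + 1), hQ (k + 1)]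
  have hΛ := tendsto_atTop_ciInf hanti ⟨0, by
    rintro _ ⟨k, rfl⟩
    linarith [hlow k, hlow₁ k, hlow₂ k, hgap k]⟩
  set V := ⨅ k, Λ k
  have hdiff : Tendsto (fun k => Λ k - Λ (k + 1)) atTop (𝓝 0) := by
    simpa using hΛ.sub ((tendsto_add_atTop_iff_nat 1).2 hΛ)
  have hPlim : Tendsto (fun k => P (k + 1)) atTop (𝓝 0) := by
    rw [← tendsto_add_atTop_iff_nat 1]
    refine squeeze_zero (fun k => hP (k + 1)) (fun k => ?_) hdiff
    linarith [hdesc k, hres₁ k, hres₂ k, hP (k + 1), hQ (k + 1)]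
  have hQlim : Tendsto (fun k => Q (k + 1)) atTop (𝓝 0) := by
    rw [← tendsto_add_atTop_iff_nat 1]
    refine squeeze_zero (fun k => hQ (k + 1)) (fun k => ?_) hdiff
    linarith [hdesc k, hres₁ k, hres₂ k, hP (k + 1), hQ (k + 1)]
  have hYdiff : Tendsto (fun k => Y (k + 1) - Y k) atTop (𝓝 0) := by
    rw [← tendsto_add_atTop_iff_nat 1]
    refine tendsto_zero_of_mul_norm_sq_le hc₁ hdiff fun k => ?_
    linarith [hdesc k, hres₁ k, hres₂ k, hP (k + 1), hQ (k + 1)]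
  have hAY : Tendsto (fun k => A (Y (k + 1) - Y k)) atTop (𝓝 0) := by
    simpa [Function.comp_def] using (A.continuous.tendsto 0).comp hYdiff
  have hXdiff : Tendsto (fun k => X (k + 1) - X k) atTop (𝓝 0) := by
    rw [← tendsto_add_atTop_iff_nat 1]
    have : Tendsto (fun k => X (k + 2) - X (k + 1) - (τ / 2) • A (Y (k + 2) - Y (k + 1))) atTop
        (𝓝 0) := tendsto_zero_of_mul_norm_sq_le hc₃ hdiff fun k => by
      linarith [hdesc k, hres₁ k, hres₂ k, hP (k + 1), hQ (k + 1)]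
    simpa using this.add (((tendsto_add_atTop_iff_nat 1).2 hAY).const_smul (τ / 2))
  have hYbdd (k : ℕ) : ‖Y (k + 1)‖ ≤ √(Λ 0 / (1 / (2 * σ) - τ / 4 * ‖A‖ ^ 2)) := by
    apply Real.le_sqrt_of_sq_le
    rw [le_div_iff₀' hc₂]
    linarith [hlow k, hlow₁ k, hlow₂ k, hgap k, hanti (Nat.zero_le k)]
  have hXbdd (k : ℕ) : ‖τ⁻¹ • X (k + 1) - A (Y (k + 1))‖ ≤ √(Λ 0 / (τ / 4)) := by
    apply Real.le_sqrt_of_sq_le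
    rw [le_div_iff₀' (by positivity)]
    linarith [hlow k, hlow₁ k, hlow₂ k, hgap k, hanti (Nat.zero_le k)]
  refine ⟨⟨τ * (√(Λ 0 / (τ / 4)) + ‖A‖ * √(Λ 0 / (1 / (2 * σ) - τ / 4 * ‖A‖ ^ 2))), fun k => ?_⟩,
    ⟨_, hYbdd⟩, hXdiff, hYdiff, hPlim, hQlim, V, ?_⟩
  · calc ‖X (k + 1)‖ = τ * ‖(τ⁻¹ • X (k + 1) - A (Y (k + 1))) + A (Y (k + 1))‖ := by
          rw [sub_add_cancel, norm_smul, norm_inv, Real.norm_of_nonneg hτ.le,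
            mul_inv_cancel_left₀ hτ.ne']
      _ ≤ _ := by
          gcongr
          exact (norm_add_le _ _).trans (add_le_add (hXbdd k)
            ((A.le_opNorm _).trans (by gcongr; exact hYbdd k)))
  · have hp : Tendsto (fun k => τ⁻¹ • (X (k + 1) - X k) - A (Y (k + 1) - Y k)) atTop (𝓝 0) := by
      simpa using (hXdiff.const_smul τ⁻¹).sub hAY
    have := (hΛ.sub ((hp.norm.pow 2).const_mul (τ / 4))).sub (hPlim.const_mul (θ - 1))
    simp only [norm_zero, ne_eq, OfNat.ofNat_ne_zero, not_false_eq_true, zero_pow, mul_zero,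
      sub_zero] at this
    refine this.congr fun k => ?_
    simp only [Λ, cpLyapunov]
    ring

/-- The KKT conditions `-A b ∈ ∂f(a)` and `A* a ∈ ∂h(b)`, written without the adjoint of `A`. -/
def IsKKT (f : E → EReal) (h : F → EReal) (A : F →L[ℝ] E) (a : E) (b : F) : Prop :=
  (∀ z, f a + ((⟪-A b, z - a⟫ : ℝ) : EReal) ≤ f z) ∧
    ∀ w, h b + ((⟪a, A (w - b)⟫ : ℝ) : EReal) ≤ h w

/-- The subgradient inequalities that characterize the Chambolle-Pock iterates; `p` and `q` are the
values of `f` and `h` along the iterates. -/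
structure IsCPSequence (τ σ θ : ℝ) (A : F →L[ℝ] E) (f : E → EReal) (h : F → EReal)
    (x : ℕ → E) (y : ℕ → F) (p q : ℕ → ℝ) : Prop where
  primal_value : ∀ k, f (x (k + 1)) = p (k + 1)
  dual_value : ∀ k, h (y (k + 1)) = q (k + 1)
  primal_step : ∀ k z, ((p (k + 1) : ℝ) : EReal)
    + ((⟪τ⁻¹ • (x k - x (k + 1)) - A (y k), z - x (k + 1)⟫ : ℝ) : EReal) ≤ f z
  dual_step : ∀ k w, ((q (k + 1) : ℝ) : EReal) + ((⟪σ⁻¹ • (y k - y (k + 1)), w - y (k + 1)⟫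
    + ⟪x (k + 1) + θ • (x (k + 1) - x k), A (w - y (k + 1))⟫ : ℝ) : EReal) ≤ h w

variable {τ σ θ : ℝ} {A : F →L[ℝ] E} {f : E → EReal} {h : F → EReal}
  {x : ℕ → E} {y : ℕ → F} {p q : ℕ → ℝ}

lemma IsCPSequence.convergence (hs : IsCPSequence τ σ θ A f h x y p q)
    (hτ : 0 < τ) (hσ : 0 < σ) (hθ : 1 / 2 < θ) (hstep : τ * σ * ‖A‖ ^ 2 < 4 / (1 + 2 * θ))
    {a : E} {b : F} (hab : IsKKT f h A a b) {fa hb : ℝ} (hfa : f a = fa) (hhb : h b = hb) :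
    (∃ C, ∀ k, ‖x (k + 1) - a‖ ≤ C) ∧ (∃ C, ∀ k, ‖y (k + 1) - b‖ ≤ C) ∧
    Tendsto (fun k => x (k + 1) - x k) atTop (𝓝 0) ∧
    Tendsto (fun k => y (k + 1) - y k) atTop (𝓝 0) ∧
    Tendsto (fun k => p (k + 1) - fa + ⟪A b, x (k + 1) - a⟫) atTop (𝓝 0) ∧
    Tendsto (fun k => q (k + 1) - hb - ⟪a, A (y (k + 1) - b)⟫) atTop (𝓝 0) ∧
    ∃ V, Tendsto (fun k => ‖x (k + 1) - a‖ ^ 2 / (2 * τ) + ‖y (k + 1) - b‖ ^ 2 / (2 * σ)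
      - ⟪x (k + 1) - a, A (y (k + 1) - b)⟫) atTop (𝓝 V) := by
  have key := cpLyapunov_convergence hτ hσ hθ hstep (X := fun k => x k - a)
    (Y := fun k => y k - b) (P := fun k => p k - fa + ⟪A b, x k - a⟫)
    (Q := fun k => q k - hb - ⟪a, A (y k - b)⟫) ?_ ?_ ?_ ?_ ?_
  · simpa only [sub_sub_sub_cancel_right] using key
  · intro k
    have := hab.1 (x (k + 1))
    rw [hfa, hs.primal_value] at this
    norm_cast at this
    rw [inner_neg_left] at this
    linarith
  · intro k
    have := hab.2 (y (k + 1))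
    rw [hhb, hs.dual_value] at this
    norm_cast at this
    linarith
  · intro k
    have := hs.primal_step k a
    rw [hfa] at this
    norm_cast at this
    simp only [sub_sub_sub_cancel_right, map_sub, inner_sub_left, inner_sub_right, inner_smul_left,
      inner_neg_right] at this ⊢
    linarith
  · intro k j
    have := hs.primal_step k (x (j + 1))
    rw [hs.primal_value] at this
    norm_cast at this
    simp only [sub_sub_sub_cancel_right, map_sub, inner_sub_left, inner_sub_right, inner_smul_left]
      at this ⊢
    linarith
  · intro k
    have := hs.dual_step k b
    rw [hhb] at this
    norm_cast at this
    simp only [sub_sub_sub_cancel_right, map_sub, map_neg, inner_sub_left, inner_sub_right,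
      inner_add_left, inner_smul_left, inner_neg_right] at this ⊢
    linarith

lemma IsKKT.inner_eq_zero {a a' : E} {b b' : F} (hab : IsKKT f h A a b) (hab' : IsKKT f h A a' b')
    {fa fa' hb hb' : ℝ} (hfa : f a = fa) (hfa' : f a' = fa') (hhb : h b = hb)
    (hhb' : h b' = hb') : ⟪a - a', A (b - b')⟫ = 0 := by
  have h₁ := hab.1 a'
  have h₂ := hab'.1 a
  have h₃ := hab.2 b'
  have h₄ := hab'.2 b
  rw [hfa, hfa'] at h₁ h₂
  rw [hhb, hhb'] at h₃ h₄
  norm_cast at h₁ h₂ h₃ h₄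
  simp only [map_sub, inner_sub_left, inner_sub_right, inner_neg_left, real_inner_comm]
    at h₁ h₂ h₃ h₄ ⊢
  linarith

variable [CompleteSpace E] [CompleteSpace F]

/-- Weak limit points of the iterates satisfy the KKT conditions. -/
lemma IsCPSequence.isKKT_of_tendsto (hs : IsCPSequence τ σ θ A f h x y p q)
    (hf : EProper f) (hf' : EConvex f) (hf'' : LowerSemicontinuous f)
    (hh : EProper h) (hh' : EConvex h) (hh'' : LowerSemicontinuous h)
    {l : Filter ℕ} [l.NeBot] {Cx Cy : ℝ} (hx : ∀ k, ‖x (k + 1)‖ ≤ Cx) (hy : ∀ k, ‖y (k + 1)‖ ≤ Cy)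
    (hdx : Tendsto (fun k => x (k + 1) - x k) l (𝓝 0))
    (hdy : Tendsto (fun k => y (k + 1) - y k) l (𝓝 0))
    {φ ψ : ℝ} (hp : Tendsto (fun k => p (k + 1)) l (𝓝 φ))
    (hq : Tendsto (fun k => q (k + 1)) l (𝓝 ψ)) {a : E} {b : F}
    (ha : ∀ u, Tendsto (fun k => ⟪x (k + 1), u⟫) l (𝓝 ⟪a, u⟫))
    (hb : ∀ v, Tendsto (fun k => ⟪y (k + 1), v⟫) l (𝓝 ⟪b, v⟫)) :
    IsKKT f h A a b ∧ (∃ r : ℝ, f a = r) ∧ ∃ r : ℝ, h b = r := by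
  have hfa : f a ≤ φ := hf'.le_of_tendsto_inner hf'' ha hp (.of_forall fun k =>
    (hs.primal_value k).le)
  have hhb : h b ≤ ψ := hh'.le_of_tendsto_inner hh'' hb hq (.of_forall fun k =>
    (hs.dual_value k).le)
  have hdAy : Tendsto (fun k => A (y (k + 1) - y k)) l (𝓝 0) := by
    simpa [Function.comp_def] using (A.continuous.tendsto 0).comp hdy
  have key (z : E) (w : F) {Z W : ℝ} (hz : f z = Z) (hw : h w = W) :
      φ + ψ - ⟪A b, z⟫ + ⟪a, A w⟫ ≤ Z + W := by
    have hbz : Tendsto (fun k => ⟪A (y (k + 1)), z⟫) l (𝓝 ⟪A b, z⟫) := by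
      simpa only [ContinuousLinearMap.adjoint_inner_right] using
        hb (ContinuousLinearMap.adjoint A z)
    have hxz : ∀ k, ‖z - x (k + 1)‖ ≤ ‖z‖ + Cx := fun k =>
      (norm_sub_le _ _).trans (by gcongr; exact hx k)
    have hyw : ∀ k, ‖w - y (k + 1)‖ ≤ ‖w‖ + Cy := fun k =>
      (norm_sub_le _ _).trans (by gcongr; exact hy k)
    have hAyw : ∀ k, ‖A (w - y (k + 1))‖ ≤ ‖A‖ * (‖w‖ + Cy) := fun k =>
      (A.le_opNorm _).trans (by gcongr; exact hyw k)
    have hlim := ((((((hp.add hq).sub hbz).add (ha (A w))).sub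
      ((tendsto_inner_zero_of_bounded hdx hxz).const_mul τ⁻¹)).sub
      ((tendsto_inner_zero_of_bounded hdy hyw).const_mul σ⁻¹)).add
      ((tendsto_inner_zero_of_bounded hdx hAyw).const_mul θ)).add
      (tendsto_inner_zero_of_bounded hdAy hxz)
    simp only [mul_zero, sub_zero, add_zero] at hlim
    refine le_of_tendsto' hlim fun k => ?_
    have h₁ := hs.primal_step k z
    have h₂ := hs.dual_step k w
    rw [hz] at h₁
    rw [hw] at h₂
    norm_cast at h₁ h₂
    simp only [map_sub, inner_sub_left, inner_sub_right, inner_add_left, inner_smul_left,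
      conj_trivial, real_inner_comm] at h₁ h₂ ⊢
    linarith
  obtain ⟨fa, hfa'⟩ : ∃ r : ℝ, f a = r :=
    ⟨_, (EReal.coe_toReal (ne_top_of_le_ne_top (EReal.coe_ne_top _) hfa) (hf.2 a)).symm⟩
  obtain ⟨hb, hhb'⟩ : ∃ r : ℝ, h b = r :=
    ⟨_, (EReal.coe_toReal (ne_top_of_le_ne_top (EReal.coe_ne_top _) hhb) (hh.2 b)).symm⟩
  refine ⟨⟨fun z => ?_, fun w => ?_⟩, ⟨fa, hfa'⟩, ⟨hb, hhb'⟩⟩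
  · rcases eq_or_ne (f z) ⊤ with hz | hz
    · rw [hz]; exact le_top
    have hz' := (EReal.coe_toReal hz (hf.2 z)).symm
    have := key z b hz' hhb'
    rw [hfa'] at hfa ⊢
    rw [hhb'] at hhb
    rw [hz']
    norm_cast at hfa hhb ⊢
    simp only [inner_neg_left, inner_sub_right]
    rw [real_inner_comm] at this
    linarith [real_inner_comm a (A b), real_inner_comm z (A b)]
  · rcases eq_or_ne (h w) ⊤ with hw | hw
    · rw [hw]; exact le_top
    have hw' := (EReal.coe_toReal hw (hh.2 w)).symm
    have := key a w hfa' hw'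
    rw [hfa'] at hfa
    rw [hhb'] at hhb ⊢
    rw [hw']
    norm_cast at hfa hhb ⊢
    simp only [map_sub, inner_sub_right]
    linarith [real_inner_comm a (A b)]

/-- Weak convergence of the Chambolle-Pock iterates to a KKT point. -/
theorem IsCPSequence.weak_convergence (hs : IsCPSequence τ σ θ A f h x y p q)
    (hf : EProper f) (hf' : EConvex f) (hf'' : LowerSemicontinuous f)
    (hh : EProper h) (hh' : EConvex h) (hh'' : LowerSemicontinuous h)
    (hτ : 0 < τ) (hσ : 0 < σ) (hθ : 1 / 2 < θ) (hstep : τ * σ * ‖A‖ ^ 2 < 4 / (1 + 2 * θ))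
    {a₀ : E} {b₀ : F} (h₀ : IsKKT f h A a₀ b₀) {fa₀ hb₀ : ℝ} (hfa₀ : f a₀ = fa₀)
    (hhb₀ : h b₀ = hb₀) :
    ∃ a b, IsKKT f h A a b ∧ (∀ u, Tendsto (fun k => ⟪x k, u⟫) atTop (𝓝 ⟪a, u⟫)) ∧
      ∀ v, Tendsto (fun k => ⟪y k, v⟫) atTop (𝓝 ⟪b, v⟫) := by
  obtain ⟨⟨Cx, hCx⟩, ⟨Cy, hCy⟩, hdx, hdy, hP, hQ, -⟩ :=
    hs.convergence hτ hσ hθ hstep h₀ hfa₀ hhb₀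
  have hx (k : ℕ) : ‖x (k + 1)‖ ≤ Cx + ‖a₀‖ := by
    simpa using (norm_add_le (x (k + 1) - a₀) a₀).trans (by gcongr; exact hCx k)
  have hy (k : ℕ) : ‖y (k + 1)‖ ≤ Cy + ‖b₀‖ := by
    simpa using (norm_add_le (y (k + 1) - b₀) b₀).trans (by gcongr; exact hCy k)
  have cluster (U : Ultrafilter ℕ) (hU : (U : Filter ℕ) ≤ atTop) :
      ∃ a b, (IsKKT f h A a b ∧ (∃ r : ℝ, f a = r) ∧ ∃ r : ℝ, h b = r) ∧
        (∀ u, Tendsto (fun k => ⟪x (k + 1), u⟫) U (𝓝 ⟪a, u⟫)) ∧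
        ∀ v, Tendsto (fun k => ⟪y (k + 1), v⟫) U (𝓝 ⟪b, v⟫) := by
    obtain ⟨a, ha⟩ := U.exists_tendsto_inner hx
    obtain ⟨b, hb⟩ := U.exists_tendsto_inner hy
    have hp : Tendsto (fun k => p (k + 1)) U (𝓝 (0 + fa₀ - (⟪a, A b₀⟫ - ⟪a₀, A b₀⟫))) := by
      refine (((hP.mono_left hU).add_const fa₀).sub ((ha (A b₀)).sub_const _)).congr fun k => ?_
      simp only [inner_sub_right, real_inner_comm (A b₀)]
      ring
    have hq : Tendsto (fun k => q (k + 1)) U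
        (𝓝 (0 + hb₀ + (⟪b, ContinuousLinearMap.adjoint A a₀⟫ - ⟪a₀, A b₀⟫))) := by
      refine (((hQ.mono_left hU).add_const hb₀).add
        ((hb (ContinuousLinearMap.adjoint A a₀)).sub_const _)).congr fun k => ?_
      simp only [ContinuousLinearMap.adjoint_inner_right, map_sub, inner_sub_right,
        real_inner_comm a₀]
      ring
    exact ⟨a, b, hs.isKKT_of_tendsto hf hf' hf'' hh hh' hh'' hx hy (hdx.mono_left hU)
      (hdy.mono_left hU) hp hq ha hb, ha, hb⟩
  obtain ⟨a, b, ⟨hab, ⟨fa, hfa⟩, ⟨hb, hhb⟩⟩, hxa, hyb⟩ := cluster (Ultrafilter.of atTop)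
    (Ultrafilter.of_le atTop)
  have unique (U : Ultrafilter ℕ) (hU : (U : Filter ℕ) ≤ atTop) :
      (∀ u, Tendsto (fun k => ⟪x (k + 1), u⟫) U (𝓝 ⟪a, u⟫)) ∧
        ∀ v, Tendsto (fun k => ⟪y (k + 1), v⟫) U (𝓝 ⟪b, v⟫) := by
    obtain ⟨a', b', ⟨hab', ⟨fa', hfa'⟩, ⟨hb', hhb'⟩⟩, hxa', hyb'⟩ := cluster U hU
    obtain ⟨-, -, -, -, -, -, V, hV⟩ := hs.convergence hτ hσ hθ hstep hab hfa hhb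
    obtain ⟨-, -, -, -, -, -, V', hV'⟩ := hs.convergence hτ hσ hθ hstep hab' hfa' hhb'
    have hzero := hab.inner_eq_zero hab' hfa hfa' hhb hhb'
    set B : E → F → ℝ := fun u v => τ⁻¹ * ⟪u, a - a'⟫ + σ⁻¹ * ⟪v, b - b'⟫
      - ⟪u, A (b - b')⟫ - ⟪v, ContinuousLinearMap.adjoint A (a - a')⟫ with hB
    have hlim {l : Filter ℕ} {c : E} {d : F}
        (hc : ∀ u, Tendsto (fun k => ⟪x (k + 1), u⟫) l (𝓝 ⟪c, u⟫))
        (hd : ∀ v, Tendsto (fun k => ⟪y (k + 1), v⟫) l (𝓝 ⟪d, v⟫)) :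
        Tendsto (fun k => B (x (k + 1)) (y (k + 1))) l (𝓝 (B c d)) :=
      ((((hc _).const_mul _).add ((hd _).const_mul _)).sub (hc _)).sub (hd _)
    obtain ⟨β, hβ⟩ : ∃ β, Tendsto (fun k => B (x (k + 1)) (y (k + 1))) atTop (𝓝 β) := by
      refine ⟨_, ((hV'.sub hV).add_const ((‖a‖ ^ 2 - ‖a'‖ ^ 2) / (2 * τ)
        + (‖b‖ ^ 2 - ‖b'‖ ^ 2) / (2 * σ) - ⟪a, A b⟫ + ⟪a', A b'⟫)).congr fun k => ?_⟩
      simp only [hB, ContinuousLinearMap.adjoint_inner_right, ← real_inner_self_eq_norm_sq,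
        map_sub, inner_sub_left, inner_sub_right, real_inner_comm]
      field_simp
      ring
    have hB₁ : B a b = β := tendsto_nhds_unique (hlim hxa hyb)
      (hβ.mono_left (Ultrafilter.of_le atTop))
    have hB₂ : B a' b' = β := tendsto_nhds_unique (hlim hxa' hyb') (hβ.mono_left hU)
    have hsum : τ⁻¹ * ‖a - a'‖ ^ 2 + σ⁻¹ * ‖b - b'‖ ^ 2 = 0 := by
      have h₁ : B a b - B a' b' = 0 := by rw [hB₁, hB₂, sub_self]
      have h₂ : B a b - B a' b' = τ⁻¹ * ‖a - a'‖ ^ 2 + σ⁻¹ * ‖b - b'‖ ^ 2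
          - 2 * ⟪a - a', A (b - b')⟫ := by
        simp only [hB, ContinuousLinearMap.adjoint_inner_right, ← real_inner_self_eq_norm_sq,
          map_sub, inner_sub_left, inner_sub_right, real_inner_comm]
        ring
      linarith
    have ha : a = a' := by
      have h₁ : 0 ≤ σ⁻¹ * ‖b - b'‖ ^ 2 := by positivity
      have h₂ : τ⁻¹ * ‖a - a'‖ ^ 2 = 0 := le_antisymm (by linarith) (by positivity)
      simpa [hτ.ne', sub_eq_zero] using h₂
    have hb : b = b' := by
      have h₁ : 0 ≤ τ⁻¹ * ‖a - a'‖ ^ 2 := by positivity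
      have h₂ : σ⁻¹ * ‖b - b'‖ ^ 2 = 0 := le_antisymm (by linarith) (by positivity)
      simpa [hσ.ne', sub_eq_zero] using h₂
    rw [ha, hb]
    exact ⟨hxa', hyb'⟩
  refine ⟨a, b, hab, fun u => (tendsto_add_atTop_iff_nat 1).1 ?_,
    fun v => (tendsto_add_atTop_iff_nat 1).1 ?_⟩
  · exact (tendsto_iff_ultrafilter _ _ _).2 fun U hU => (unique U hU).1 u
  · exact (tendsto_iff_ultrafilter _ _ _).2 fun U hU => (unique U hU).2 v

end Convergence

theorem chambolle_pock_weak_convergence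
    {𝓗 𝓖 : Type*}
    [NormedAddCommGroup 𝓗] [InnerProductSpace ℝ 𝓗] [CompleteSpace 𝓗]
    [NormedAddCommGroup 𝓖] [InnerProductSpace ℝ 𝓖] [CompleteSpace 𝓖]
    (f : 𝓗 → EReal) (g : 𝓖 → EReal) (gs : 𝓖 → EReal)
    (hf₁ : EProper f) (hf₂ : EConvex f) (hf₃ : LowerSemicontinuous f)
    (hg₁ : EProper g) (hg₂ : EConvex g) (hg₃ : LowerSemicontinuous g)
    (hgs : gs = EConj g)
    (L : 𝓗 →L[ℝ] 𝓖) (hL : L ≠ 0)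
    (τ σ θ : ℝ) (hτ : 0 < τ) (hσ : 0 < σ)
    (hθ : 1 / 2 < θ) (hstep : τ * σ * ‖L‖ ^ 2 < 4 / (1 + 2 * θ))
    (hexist : ∃ (xstar : 𝓗) (ystar : 𝓖),
      -((ContinuousLinearMap.adjoint L) ystar) ∈ ESubdiff f xstar ∧
        L xstar ∈ ESubdiff gs ystar)
    (x : ℕ → 𝓗) (y : ℕ → 𝓖)
    (hx : ∀ k : ℕ, IsProx τ f (x k - τ • (ContinuousLinearMap.adjoint L) (y k)) (x (k + 1)))
    (hy : ∀ k : ℕ,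
      IsProx σ gs (y k + σ • L (x (k + 1) + θ • (x (k + 1) - x k))) (y (k + 1)))
    :
    ∃ (xstar : 𝓗) (ystar : 𝓖),
      -((ContinuousLinearMap.adjoint L) ystar) ∈ ESubdiff f xstar ∧
      L xstar ∈ ESubdiff gs ystar ∧
      (∀ u : 𝓗, Tendsto (fun k => ⟪x k, u⟫) atTop (𝓝 ⟪xstar, u⟫)) ∧
      (∀ v : 𝓖, Tendsto (fun k => ⟪y k, v⟫) atTop (𝓝 ⟪ystar, v⟫)) := by
  have hgsp : EProper gs := hgs ▸ hg₁.econj hg₂ hg₃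
  have hgsc : EConvex gs := hgs ▸ EConvex.econj g hg₁.2
  have hgsl : LowerSemicontinuous gs := hgs ▸ lowerSemicontinuous_econj g
  set A := ContinuousLinearMap.adjoint L with hA
  have hadj (u : 𝓗) (v : 𝓖) : ⟪u, A v⟫ = ⟪L u, v⟫ := ContinuousLinearMap.adjoint_inner_right L u v
  have hKKT (a : 𝓗) (b : 𝓖) :
      IsKKT f gs A a b ↔ -(A b) ∈ ESubdiff f a ∧ L a ∈ ESubdiff gs b := by
    simp only [IsKKT, ESubdiff, Set.mem_ofPred_eq, hadj]
  have hs : IsCPSequence τ σ θ A f gs x y (fun k => (f (x k)).toReal)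
      (fun k => (gs (y k)).toReal) := by
    have hpv (k : ℕ) : f (x (k + 1)) = ((f (x (k + 1))).toReal : EReal) :=
      (EReal.coe_toReal ((hx k).ne_top hf₁.1) (hf₁.2 _)).symm
    have hqv (k : ℕ) : gs (y (k + 1)) = ((gs (y (k + 1))).toReal : EReal) :=
      (EReal.coe_toReal ((hy k).ne_top hgsp.1) (hgsp.2 _)).symm
    refine ⟨hpv, hqv, fun k z => ?_, fun k w => ?_⟩
    · have := (hx k).mem_ESubdiff hf₂ hf₁ hτ z
      rw [← hpv]
      convert! this using 4
      rw [sub_right_comm, smul_sub τ⁻¹ (x k - x (k + 1)), inv_smul_smul₀ hτ.ne']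
    · have := (hy k).mem_ESubdiff hgsc hgsp hσ w
      rw [← hqv]
      convert! this using 3
      rw [hadj, ← inner_add_left, add_sub_right_comm, smul_add, inv_smul_smul₀ hσ.ne']
  obtain ⟨a₀, b₀, ha₀, hb₀⟩ := hexist
  obtain ⟨a, b, hab, hxa, hyb⟩ := hs.weak_convergence hf₁ hf₂ hf₃ hgsp hgsc hgsl hτ hσ hθ
    (by rwa [hA, LinearIsometryEquiv.norm_map]) ((hKKT a₀ b₀).2 ⟨ha₀, hb₀⟩)
    (EReal.coe_toReal (hf₁.ne_top_of_mem_ESubdiff ha₀) (hf₁.2 _)).symm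
    (EReal.coe_toReal (hgsp.ne_top_of_mem_ESubdiff hb₀) (hgsp.2 _)).symm
  exact ⟨a, b, ((hKKT a b).1 hab).1, ((hKKT a b).1 hab).2, hxa, hyb⟩
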